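/- arXiv:2506.20459 — 2 statements merged into one kernel-verified Lean document; each statement's English description precedes it below -/
import Mathlib

section
/- Let β ∈ ℝ∖ℚ, u, t, s ∈ ℝ, let c ≥ 1 be an integer, k ∈ ℤ∖{0}, l ≥ 1 an integer, and q, r ∈ (1/c)·ℤ. Let p(x) = P(x) + ρ where P is a nonconstant polynomial with integer coefficients and ρ ∈ ℝ, and set a(n) = (p(n) − k·u)/(k·β + l). For j ∈ {1, …, |ck|} and j' ∈ {0, …, |ckl| − 1} define w := (k(q − t) − l(r + s))/|kl|, x_{j,j'} := |k|·{(p(j) − sgn(k)·j')/k}, and b_{j,j'} := ⌊sgn(k)·(j' + 1_{k<0})/l⌋·t − ⌊(p(j) − sgn(k)·j')/k⌋·s, where sgn(k) = ±1 is the sign of k and 1_{k<0} is 1 if k < 0 and 0 otherwise. Then lim_{N→∞} (1/N)·Σ_{n=1}^N e(q·a(n) + β·r·a(n) − {a(n)}·t + {β·a(n)+u}·s) = 0 if and only if one of the following holds: (i) w = 0 and (1/|ck|)·Σ_{j=1}^{|ck|} e((r+s)·p(j)/k) · (1/|ckl|)·Σ_{j'=0}^{|ckl|−1} e(b_{j,j'})·(e(s)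 + min(x_{j,j'}, 1)·(1 − e(s))) = 0; (ii) w ≠ 0 and (1/|ck|)·Σ_{j=1}^{|ck|} e((r+s)·p(j)/k) · (1/|ckl|)·Σ_{j'=0}^{|ckl|−1} e(j'·w + b_{j,j'})·(e(s)·(e(w) − 1) + (1 − e(s))·(e(w·min(x_{j,j'}, 1)) − 1)) = 0. -/
open Filter Finset
open scoped Classical

noncomputable section

/-- `e(x) = exp(2πix)`. -/
def e (x : ℝ) : ℂ := Complex.exp (2 * (Real.pi : ℂ) * Complex.I * (x : ℂ))

/-- The sign `sgn(k) = ±1` of a (nonzero) integer `k`. -/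
def sgn (k : ℤ) : ℝ := if k < 0 then -1 else 1

/-- The indicator `1_{k<0}`. -/
def indNeg (k : ℤ) : ℝ := if k < 0 then 1 else 0

/-- `w := (k(q − t) − l(r + s))/|kl|`. -/
def wval (k l : ℤ) (q r t s : ℝ) : ℝ :=
  ((k : ℝ) * (q - t) - (l : ℝ) * (r + s)) / |(k : ℝ) * (l : ℝ)|

/-- `x_{j,j'} := |k|·{(p(j) − sgn(k)·j')/k}`. -/
def xval (p : ℕ → ℝ) (k : ℤ) (j j' : ℕ) : ℝ :=
  |(k : ℝ)| * Int.fract ((p j - sgn k * (j' : ℝ)) / (k : ℝ))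

/-- `b_{j,j'} := ⌊sgn(k)·(j' + 1_{k<0})/l⌋·t − ⌊(p(j) − sgn(k)·j')/k⌋·s`. -/
def bval (p : ℕ → ℝ) (k l : ℤ) (t s : ℝ) (j j' : ℕ) : ℝ :=
  (⌊sgn k * ((j' : ℝ) + indNeg k) / (l : ℝ)⌋ : ℝ) * t -
    (⌊(p j - sgn k * (j' : ℝ)) / (k : ℝ)⌋ : ℝ) * s

/-- The Cesàro average `(1/N) ∑_{n < N} u n`. -/
def avg (u : ℕ → ℂ) (N : ℕ) : ℂ := (N : ℂ)⁻¹ * ∑ n ∈ Finset.range N, u n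

theorem e_add (x y : ℝ) : e (x + y) = e x * e y := by
  simp only [e, ← Complex.exp_add]; congr 1; push_cast; ring

theorem e_zero : e 0 = 1 := by simp [e]

theorem e_int (m : ℤ) : e m = 1 := by
  have := Complex.exp_int_mul_two_pi_mul_I m
  rw [e, ← this]; congr 1; push_cast; ring

theorem norm_e (x : ℝ) : ‖e x‖ = 1 := by
  have : e x = Complex.exp (((2 * Real.pi * x : ℝ) : ℂ) * Complex.I) := by
    rw [e]; congr 1; push_cast; ring
  rw [this, Complex.norm_exp_ofReal_mul_I]

theorem e_ne_zero (x : ℝ) : e x ≠ 0 := Complex.exp_ne_zero _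

theorem e_neg (x : ℝ) : e (-x) = starRingEnd ℂ (e x) := by
  simp only [e, ← Complex.exp_conj]; congr 1; simp [map_ofNat]

theorem e_natCast_mul (n : ℕ) (x : ℝ) : e (n * x) = e x ^ n := by
  rw [e, e, ← Complex.exp_nat_mul]; congr 1; push_cast; ring

theorem continuous_e : Continuous e := by unfold e; fun_prop

theorem e_eq_one_iff (x : ℝ) : e x = 1 ↔ ∃ m : ℤ, x = m := by
  rw [e, Complex.exp_eq_one_iff]
  constructor
  · rintro ⟨m, hm⟩
    refine ⟨m, ?_⟩
    have h : (2 * (Real.pi : ℂ) * Complex.I) ≠ 0 := by simp [Real.pi_ne_zero]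
    have : (x : ℂ) = m := by
      apply mul_left_cancel₀ h; rw [hm]; ring
    exact_mod_cast this
  · rintro ⟨m, rfl⟩
    exact ⟨m, by push_cast; ring⟩

theorem avg_add (u v : ℕ → ℂ) (N : ℕ) : avg (fun n => u n + v n) N = avg u N + avg v N := by
  simp only [avg, Finset.sum_add_distrib, mul_add]

theorem avg_sub (u v : ℕ → ℂ) (N : ℕ) : avg (fun n => u n - v n) N = avg u N - avg v N := by
  simp only [avg, Finset.sum_sub_distrib, mul_sub]

theorem avg_const_mul (c : ℂ) (u : ℕ → ℂ) (N : ℕ) : avg (fun n => c * u n) N = c * avg u N := by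
  simp only [avg, ← Finset.mul_sum]; ring

theorem avg_finsetSum {ι : Type*} (s : Finset ι) (u : ι → ℕ → ℂ) (N : ℕ) :
    avg (fun n => ∑ i ∈ s, u i n) N = ∑ i ∈ s, avg (u i) N := by
  simp only [avg, Finset.sum_comm (s := Finset.range N), Finset.mul_sum]

theorem avg_conj (u : ℕ → ℂ) (N : ℕ) :
    avg (fun n => starRingEnd ℂ (u n)) N = starRingEnd ℂ (avg u N) := by
  simp [avg]

theorem norm_avg_le_avg {u : ℕ → ℂ} {v : ℕ → ℝ} (h : ∀ n, ‖u n‖ ≤ v n) (N : ℕ) :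
    ‖avg u N‖ ≤ ‖avg (fun n => (v n : ℂ)) N‖ := by
  have h1 : ‖∑ n ∈ Finset.range N, u n‖ ≤ ∑ n ∈ Finset.range N, v n :=
    norm_sum_le_of_le _ fun n _ => h n
  have h2 : ‖∑ n ∈ Finset.range N, (v n : ℂ)‖ = ∑ n ∈ Finset.range N, v n := by
    rw [← Complex.ofReal_sum, Complex.norm_real, Real.norm_of_nonneg]
    exact Finset.sum_nonneg fun n _ => (norm_nonneg _).trans (h n)
  rw [avg, avg, norm_mul, norm_mul, h2]
  gcongr

theorem norm_avg_le {u : ℕ → ℂ} {C : ℝ} (h : ∀ n, ‖u n‖ ≤ C) (N : ℕ) : ‖avg u N‖ ≤ C := by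
  have hC : 0 ≤ C := (norm_nonneg _).trans (h 0)
  rcases Nat.eq_zero_or_pos N with rfl | hN
  · simpa [avg] using hC
  refine (norm_avg_le_avg (v := fun _ => C) h N).trans ?_
  have : (N : ℂ) ≠ 0 := by exact_mod_cast hN.ne'
  simp [avg, this, abs_of_nonneg hC]

theorem tendsto_avg_const (c : ℂ) : Tendsto (avg fun _ => c) atTop (nhds c) := by
  refine tendsto_const_nhds.congr' ?_
  filter_upwards [eventually_gt_atTop 0] with N hN
  have : (N : ℂ) ≠ 0 := by exact_mod_cast hN.ne'
  simp [avg, this]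

theorem tendsto_avg_succ_sub {u : ℕ → ℂ} {C : ℝ} (h : ∀ n, ‖u n‖ ≤ C) :
    Tendsto (fun N => avg (fun n => u (n + 1)) N - avg u N) atTop (nhds 0) := by
  have key : ∀ N, avg (fun n => u (n + 1)) N - avg u N = (N : ℂ)⁻¹ * (u N - u 0) := by
    intro N
    rw [avg, avg, ← mul_sub, ← Finset.sum_sub_distrib, Finset.sum_range_sub]
  refine squeeze_zero_norm (a := fun N : ℕ => (N : ℝ)⁻¹ * (C + C)) (fun N => ?_) ?_
  · rw [key, norm_mul, norm_inv, Complex.norm_natCast]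
    gcongr
    exact (norm_sub_le _ _).trans (add_le_add (h _) (h _))
  · simpa using (tendsto_inv_atTop_nhds_zero_nat (𝕜 := ℝ)).mul_const (C + C)

theorem tendsto_avg_shift_sub {u : ℕ → ℂ} {C : ℝ} (h : ∀ n, ‖u n‖ ≤ C) (k : ℕ) :
    Tendsto (fun N => avg (fun n => u (n + k)) N - avg u N) atTop (nhds 0) := by
  induction k with
  | zero => simp
  | succ k ih =>
    have := (tendsto_avg_succ_sub (u := fun n => u (n + k)) fun n => h _).add ih
    rw [add_zero] at this
    refine this.congr fun N => ?_
    simp only [Nat.add_assoc, Nat.add_comm 1 k]; ring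

theorem tendsto_avg_shift {u : ℕ → ℂ} {C : ℝ} (h : ∀ n, ‖u n‖ ≤ C) {L : ℂ}
    (hL : Tendsto (avg u) atTop (nhds L)) (k : ℕ) :
    Tendsto (avg fun n => u (n + k)) atTop (nhds L) := by
  have := (tendsto_avg_shift_sub h k).add hL
  rw [zero_add] at this
  exact this.congr fun N => by ring

theorem norm_avg_sq_le (u : ℕ → ℂ) (N : ℕ) :
    ‖avg u N‖ ^ 2 ≤ ‖avg (fun n => u n * starRingEnd ℂ (u n)) N‖ := by
  have h1 : (∑ n ∈ Finset.range N, ‖u n‖) ^ 2 ≤ N * ∑ n ∈ Finset.range N, ‖u n‖ ^ 2 := by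
    simpa using sq_sum_le_card_mul_sum_sq (s := Finset.range N) (f := fun n => ‖u n‖)
  have h2 : ‖∑ n ∈ Finset.range N, u n * starRingEnd ℂ (u n)‖
      = ∑ n ∈ Finset.range N, ‖u n‖ ^ 2 := by
    have : ∀ n, u n * starRingEnd ℂ (u n) = ((‖u n‖ ^ 2 : ℝ) : ℂ) := fun n => by
      rw [Complex.mul_conj, Complex.normSq_eq_norm_sq]
    simp only [this]
    rw [← Complex.ofReal_sum, Complex.norm_real, Real.norm_of_nonneg]
    exact Finset.sum_nonneg fun n _ => sq_nonneg _
  rcases Nat.eq_zero_or_pos N with rfl | hN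
  · simp [avg]
  have hN' : (0 : ℝ) < N := by exact_mod_cast hN
  rw [avg, avg, norm_mul, norm_mul, h2, norm_inv, Complex.norm_natCast, mul_pow]
  calc ((N : ℝ)⁻¹) ^ 2 * ‖∑ n ∈ Finset.range N, u n‖ ^ 2
      ≤ ((N : ℝ)⁻¹) ^ 2 * (N * ∑ n ∈ Finset.range N, ‖u n‖ ^ 2) := by
        gcongr
        exact le_trans (by gcongr; exact norm_sum_le _ _) h1
    _ = _ := by field_simp

/-- Van der Corput's difference theorem for unimodular sequences. -/
theorem tendsto_avg_zero_of_correlations {u : ℕ → ℂ} (hu : ∀ n, ‖u n‖ = 1)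
    (h : ∀ d : ℕ, 0 < d →
      Tendsto (avg fun n => u (n + d) * starRingEnd ℂ (u n)) atTop (nhds 0)) :
    Tendsto (avg u) atTop (nhds 0) := by
  have hle : ∀ n, ‖u n‖ ≤ 1 := fun n => (hu n).le
  have corr : ∀ i j : ℕ, Tendsto (avg fun n => u (n + i) * starRingEnd ℂ (u (n + j))) atTop
      (nhds (if i = j then 1 else 0)) := by
    have base : ∀ i j : ℕ, j < i →
        Tendsto (avg fun n => u (n + i) * starRingEnd ℂ (u (n + j))) atTop (nhds 0) := by
      intro i j hij
      obtain ⟨d, rfl⟩ := Nat.exists_eq_add_of_lt hij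
      have := tendsto_avg_shift (C := 1) (fun n => by simp [hu]) (h (d + 1) (by omega)) j
      refine this.congr fun N => ?_
      congr 1; funext n; congr 2; omega
    intro i j
    rcases lt_trichotomy i j with hij | rfl | hij
    · rw [if_neg hij.ne]
      have := (Complex.continuous_conj.tendsto _).comp (base j i hij)
      rw [map_zero] at this
      refine this.congr fun N => ?_
      rw [Function.comp_apply, ← avg_conj]
      congr 1; funext n; simp [mul_comm]
    · rw [if_pos rfl]
      refine (tendsto_avg_const 1).congr fun N => ?_
      congr 1; funext n
      rw [Complex.mul_conj, Complex.normSq_eq_norm_sq, hu]; simp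
    · rw [if_neg hij.ne']; exact base i j hij
  rw [Metric.tendsto_nhds]
  intro ε hε
  obtain ⟨H, hH⟩ := exists_nat_gt (8 / ε ^ 2 + 2 / ε)
  have hHpos : (0 : ℝ) < H := lt_trans (by positivity) hH
  set S : ℕ → ℂ := fun n => ∑ i ∈ Finset.range H, u (n + i) with hS
  have t1 : Tendsto (fun N => avg S N - H * avg u N) atTop (nhds 0) := by
    have := tendsto_finsetSum (Finset.range H) fun i _ => tendsto_avg_shift_sub hle i
    simp only [Finset.sum_const_zero] at this
    refine this.congr fun N => ?_
    simp [hS, avg_finsetSum, Finset.sum_sub_distrib]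
  have t2 : Tendsto (avg fun n => S n * starRingEnd ℂ (S n)) atTop (nhds (H : ℂ)) := by
    have := tendsto_finsetSum (Finset.range H) fun i _ =>
      tendsto_finsetSum (Finset.range H) fun j _ => corr i j
    have hval : (∑ i ∈ Finset.range H, ∑ j ∈ Finset.range H, if i = j then (1 : ℂ) else 0)
        = H := by
      rw [Finset.sum_congr rfl (g := fun _ => 1)]
      · simp
      · intro i hi
        rw [Finset.sum_ite_eq, if_pos hi]
    rw [hval] at this
    refine this.congr fun N => ?_
    simp only [← avg_finsetSum]
    congr 1; funext n
    simp only [hS, map_sum, Finset.sum_mul_sum]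
  have t3 : ∀ᶠ N in atTop, ‖avg (fun n => S n * starRingEnd ℂ (S n)) N‖ < 2 * H := by
    refine (t2.norm).eventually_lt_const ?_
    rw [Complex.norm_natCast]; linarith
  have t4 : ∀ᶠ N in atTop, ‖avg S N - H * avg u N‖ < 1 :=
    t1.norm.eventually_lt_const (by simp)
  filter_upwards [t3, t4] with N h3 h4
  rw [dist_zero_right]
  by_contra! hcon
  have h5 : (H : ℝ) * ε ≤ ‖avg S N‖ + 1 := by
    have : ‖(H : ℂ) * avg u N‖ ≤ ‖avg S N‖ + ‖avg S N - H * avg u N‖ := by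
      have := norm_sub_le (avg S N) (avg S N - H * avg u N)
      rwa [sub_sub_cancel] at this
    rw [norm_mul, Complex.norm_natCast] at this
    nlinarith
  have h6 := (norm_avg_sq_le S N).trans_lt h3
  have h7 : 2 < H * ε := by
    have : 2 / ε < H := lt_trans (by linarith [show 0 < 8 / ε ^ 2 by positivity]) hH
    rwa [div_lt_iff₀ hε] at this
  have h8 : 8 < H * ε ^ 2 := by
    have : 8 / ε ^ 2 < H := lt_trans (by linarith [show 0 < 2 / ε by positivity]) hH
    rwa [div_lt_iff₀ (by positivity)] at this
  have h9 : H * ε / 2 < ‖avg S N‖ := by linarith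
  have h10 : (H * ε / 2) ^ 2 < ‖avg S N‖ ^ 2 := by gcongr
  nlinarith

theorem tendsto_avg_pow {z : ℂ} (hz : ‖z‖ = 1) (hz1 : z ≠ 1) :
    Tendsto (avg fun n => z ^ n) atTop (nhds 0) := by
  refine squeeze_zero_norm (a := fun N : ℕ => (N : ℝ)⁻¹ * (2 / ‖z - 1‖)) (fun N => ?_) ?_
  · rw [avg, geom_sum_eq hz1, norm_mul, norm_inv, Complex.norm_natCast, norm_div]
    gcongr
    refine (norm_sub_le _ _).trans ?_
    rw [norm_pow, hz]; norm_num
  · simpa using (tendsto_inv_atTop_nhds_zero_nat (𝕜 := ℝ)).mul_const (2 / ‖z - 1‖)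

/-- Weyl's theorem: a sequence whose `(d + 1)`-st difference is an irrational constant
has vanishing exponential averages. -/
theorem tendsto_avg_e_of_fwdDiff_iter (d : ℕ) (f : ℕ → ℝ) (α : ℝ) (hα : Irrational α)
    (hf : ∀ n, (fwdDiff 1)^[d + 1] f n = α) :
    Tendsto (avg fun n => e (f n)) atTop (nhds 0) := by
  induction d generalizing f α with
  | zero =>
    have hlin : ∀ n : ℕ, f n = f 0 + n * α := by
      intro n
      induction n with
      | zero => simp
      | succ n ih =>
        have := hf n
        simp only [zero_add, Function.iterate_one, fwdDiff] at this
        push_cast; linarith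
    have hz1 : e α ≠ 1 := by
      rw [Ne, e_eq_one_iff]
      rintro ⟨m, rfl⟩
      exact (Int.not_irrational m) hα
    have := (tendsto_avg_pow (norm_e α) hz1).const_mul (e (f 0))
    rw [mul_zero] at this
    refine this.congr fun N => ?_
    rw [← avg_const_mul]
    congr 1; funext n
    rw [hlin n, e_add, e_natCast_mul]
  | succ d ih =>
    refine tendsto_avg_zero_of_correlations (fun n => norm_e _) fun k hk => ?_
    have := ih (fun n => f (n + k) - f n) (k * α) (hα.natCast_mul hk.ne') fun n => by
      have hsum : (fun n => f (n + k) - f n)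
          = ∑ i ∈ Finset.range k, fun n => fwdDiff 1 f (n + i) := by
        funext n
        rw [Finset.sum_apply]
        have := Finset.sum_range_sub (fun i => f (n + i)) k
        simp only [fwdDiff, Nat.add_assoc] at this ⊢
        simpa using this.symm
      rw [hsum, fwdDiff_iter_finsetSum, Finset.sum_apply]
      have : ∀ i ∈ Finset.range k,
          (fwdDiff 1)^[d + 1] (fun n => fwdDiff 1 f (n + i)) n = α := fun i _ => by
        rw [fwdDiff_iter_comp_add, ← Function.iterate_succ_apply]
        exact hf _
      rw [Finset.sum_congr rfl this]; simp
    refine this.congr fun N => ?_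
    congr 1; funext n
    rw [sub_eq_add_neg, e_add, e_neg]

theorem integral_fourier {T : ℝ} [hT : Fact (0 < T)] (m : ℤ) :
    ∫ y : AddCircle T, fourier m y ∂AddCircle.haarAddCircle = if m = 0 then 1 else 0 := by
  split_ifs with hm
  · subst hm; simp
  · exact MeasureTheory.integral_eq_zero_of_add_right_eq_neg
      (fourier_add_half_inv_index hm hT.out)

/-- Weyl's criterion with weights, for continuous functions on the circle. -/
theorem tendsto_avg_mul_continuousMap {T : ℝ} [hT : Fact (0 < T)] {x : ℕ → ℝ} {v : ℕ → ℂ} {V : ℂ}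
    (hv : ∀ n, ‖v n‖ ≤ 1)
    (h : ∀ m : ℤ, Tendsto (avg fun n => v n * e (m * x n / T)) atTop
      (nhds (if m = 0 then V else 0)))
    (G : C(AddCircle T, ℂ)) :
    Tendsto (avg fun n => v n * G (x n)) atTop
      (nhds (V * ∫ y, G y ∂AddCircle.haarAddCircle)) := by
  have hint : ∀ G : C(AddCircle T, ℂ), MeasureTheory.Integrable G AddCircle.haarAddCircle :=
    fun G => G.continuous.integrable_of_hasCompactSupport (HasCompactSupport.of_compactSpace _)
  have hV : ‖V‖ ≤ 1 := by
    refine le_of_tendsto (by simpa using (h 0).norm) (.of_forall fun N => ?_)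
    exact norm_avg_le (fun n => by simpa [e_zero] using hv n) N
  have hspan : ∀ G ∈ Submodule.span ℂ (Set.range (@fourier T)),
      Tendsto (avg fun n => v n * G (x n)) atTop
        (nhds (V * ∫ y, G y ∂AddCircle.haarAddCircle)) := by
    intro G hG
    induction hG using Submodule.span_induction with
    | mem G hG =>
      obtain ⟨m, rfl⟩ := hG
      rw [integral_fourier, mul_ite, mul_one, mul_zero]
      refine (h m).congr fun N => ?_
      congr 1; funext n
      rw [fourier_coe_apply, e]
      congr 2; push_cast; ring
    | zero => simpa using tendsto_avg_const 0
    | add G H _ _ hG hH =>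
      simp only [ContinuousMap.add_apply, mul_add]
      rw [MeasureTheory.integral_add (hint G) (hint H), mul_add]
      exact (hG.add hH).congr fun N => (avg_add _ _ N).symm
    | smul c G _ hG =>
      simp only [ContinuousMap.smul_apply, smul_eq_mul]
      rw [MeasureTheory.integral_const_mul, mul_left_comm]
      refine (hG.const_mul c).congr fun N => ?_
      rw [← avg_const_mul]
      congr 1; funext n; ring
  rw [Metric.tendsto_nhds]
  intro ε hε
  have hG : G ∈ (Submodule.span ℂ (Set.range (@fourier T))).topologicalClosure := by
    rw [span_fourier_closure_eq_top]; trivial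
  obtain ⟨G', hG', hd⟩ := Metric.mem_closure_iff.mp hG (ε / 3) (by positivity)
  rw [dist_eq_norm] at hd
  have hpt : ∀ y, ‖G y - G' y‖ ≤ ε / 3 := fun y =>
    ((G - G').norm_coe_le_norm y).trans hd.le
  have h1 : ∀ N, ‖avg (fun n => v n * G (x n)) N - avg (fun n => v n * G' (x n)) N‖ ≤ ε / 3 := by
    intro N
    rw [← avg_sub]
    refine norm_avg_le (fun n => ?_) N
    rw [← mul_sub, norm_mul]
    exact (mul_le_mul (hv n) (hpt _) (norm_nonneg _) zero_le_one).trans (one_mul _).le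
  have h2 : ‖V * ∫ y, G' y ∂AddCircle.haarAddCircle
      - V * ∫ y, G y ∂AddCircle.haarAddCircle‖ ≤ ε / 3 := by
    rw [← mul_sub, ← MeasureTheory.integral_sub (hint G') (hint G), norm_mul]
    have : ‖∫ y, (G' y - G y) ∂AddCircle.haarAddCircle‖ ≤ ε / 3 := by
      refine (MeasureTheory.norm_integral_le_of_norm_le_const (C := ε / 3)
        (.of_forall fun y => by rw [norm_sub_rev]; exact hpt y)).trans ?_
      simp
    exact (mul_le_mul hV this (norm_nonneg _) zero_le_one).trans (one_mul _).le
  filter_upwards [(Metric.tendsto_nhds.mp (hspan G' hG')) (ε / 3) (by positivity)] with N hN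
  rw [dist_eq_norm] at hN ⊢
  have := norm_add₃_le (a := avg (fun n => v n * G (x n)) N - avg (fun n => v n * G' (x n)) N)
    (b := avg (fun n => v n * G' (x n)) N - V * ∫ y, G' y ∂AddCircle.haarAddCircle)
    (c := V * ∫ y, G' y ∂AddCircle.haarAddCircle - V * ∫ y, G y ∂AddCircle.haarAddCircle)
  rw [sub_add_sub_cancel, sub_add_sub_cancel] at this
  linarith [h1 N]

theorem tendsto_avg_mul_of_continuous {T : ℝ} (hT : 0 < T) {x : ℕ → ℝ} {v : ℕ → ℂ} {V : ℂ}
    (hv : ∀ n, ‖v n‖ ≤ 1)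
    (h : ∀ m : ℤ, Tendsto (avg fun n => v n * e (m * x n / T)) atTop
      (nhds (if m = 0 then V else 0)))
    {G : ℝ → ℂ} (hG : Continuous G) (hper : Function.Periodic G T) :
    Tendsto (avg fun n => v n * G (x n)) atTop
      (nhds (V * ((T : ℂ)⁻¹ * ∫ y in (0 : ℝ)..T, G y))) := by
  have : Fact (0 < T) := ⟨hT⟩
  let G' : C(AddCircle T, ℂ) := ⟨hper.lift, continuous_coinduced_dom.mpr hG⟩
  have hG' : ∀ y : ℝ, G' y = G y := fun y => hper.lift_coe y
  have := tendsto_avg_mul_continuousMap hv h G'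
  simp only [hG'] at this
  rw [AddCircle.integral_haarAddCircle, ← AddCircle.intervalIntegral_preimage T 0, zero_add] at this
  simpa only [hG', Complex.real_smul, Complex.ofReal_inv] using this

/-- Weyl's criterion with weights, for bounded periodic functions which are continuous
off a closed countable set. -/
theorem tendsto_avg_mul_of_continuousAt {T : ℝ} (hT : 0 < T) {x : ℕ → ℝ} {v : ℕ → ℂ} {V : ℂ}
    (hv : ∀ n, ‖v n‖ ≤ 1)
    (h : ∀ m : ℤ, Tendsto (avg fun n => v n * e (m * x n / T)) atTop
      (nhds (if m = 0 then V else 0)))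
    (h₁ : ∀ m : ℤ, Tendsto (avg fun n => e (m * x n / T)) atTop
      (nhds (if m = 0 then 1 else 0)))
    {F : ℝ → ℂ} (hper : Function.Periodic F T) (hF : ∀ y, ‖F y‖ ≤ 1) (hmeas : Measurable F)
    {D : Set ℝ} (hD : IsClosed D) (hDne : D.Nonempty) (hDc : D.Countable)
    (hDT : ∀ y, y + T ∈ D ↔ y ∈ D)
    (hcont : ∀ y ∉ D, ContinuousAt F y) :
    Tendsto (avg fun n => v n * F (x n)) atTop
      (nhds (V * ((T : ℂ)⁻¹ * ∫ y in (0 : ℝ)..T, F y))) := by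
  have hV : ‖V‖ ≤ 1 := by
    refine le_of_tendsto (by simpa using (h 0).norm) (.of_forall fun N => ?_)
    exact norm_avg_le (fun n => by simpa [e_zero] using hv n) N
  set χ : ℕ → ℝ → ℝ := fun m y => min 1 (m * Metric.infDist y D) with hχ
  have hχ0 : ∀ m y, 0 ≤ χ m y := fun m y =>
    le_min zero_le_one (mul_nonneg (Nat.cast_nonneg _) Metric.infDist_nonneg)
  have hχ1 : ∀ m y, χ m y ≤ 1 := fun m y => min_le_left _ _
  have hχc : ∀ m, Continuous (χ m) := fun m =>
    continuous_const.min (continuous_const.mul (Metric.continuous_infDist_pt D))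
  have hχD : ∀ m, ∀ y ∈ D, χ m y = 0 := fun m y hy => by
    simp [hχ, Metric.infDist_zero_of_mem hy]
  have hinf : Function.Periodic (fun y => Metric.infDist y D) T := by
    intro y
    have himg : D = (IsometryEquiv.addRight T) '' D := by
      ext z
      constructor
      · intro hz
        refine ⟨z - T, (hDT _).mp ?_, ?_⟩ <;> simp [hz]
      · rintro ⟨w, hw, rfl⟩
        exact (hDT w).mpr hw
    have := Metric.infDist_image (t := D) (IsometryEquiv.addRight T).isometry (x := y)
    rw [← himg] at this
    exact this
  have hχper : ∀ m, Function.Periodic (χ m) T := fun m y => by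
    have := hinf y
    simp only at this
    simp only [hχ, this]
  have hχlim : ∀ y ∉ D, Tendsto (fun m => χ m y) atTop (nhds 1) := by
    intro y hy
    have hpos : 0 < Metric.infDist y D := (hD.notMem_iff_infDist_pos hDne).mp hy
    obtain ⟨M, hM⟩ := exists_nat_gt (1 / Metric.infDist y D)
    refine tendsto_const_nhds.congr' ?_
    filter_upwards [eventually_ge_atTop M] with m hm
    refine (min_eq_left ?_).symm
    rw [div_lt_iff₀ hpos] at hM
    have : (M : ℝ) ≤ m := by exact_mod_cast hm
    nlinarith
  have hcontF : ∀ m, Continuous fun y => F y * (χ m y : ℂ) := by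
    intro m
    rw [continuous_iff_continuousAt]
    intro y
    by_cases hy : y ∈ D
    · have h0 : F y * (χ m y : ℂ) = 0 := by simp [hχD m y hy]
      rw [ContinuousAt, h0]
      refine squeeze_zero_norm (a := χ m) (fun z => ?_) ?_
      · rw [norm_mul, Complex.norm_real, Real.norm_of_nonneg (hχ0 m z)]
        exact (mul_le_mul_of_nonneg_right (hF z) (hχ0 m z)).trans (one_mul _).le
      · have := (hχc m).tendsto y
        rwa [hχD m y hy] at this
    · exact (hcont y hy).mul (Complex.continuous_ofReal.continuousAt.comp (hχc m).continuousAt)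
  have hint : Tendsto (fun m => ∫ y in (0 : ℝ)..T, (1 - χ m y)) atTop (nhds 0) := by
    have : Tendsto (fun m => ∫ y in (0 : ℝ)..T, (1 - χ m y)) atTop
        (nhds (∫ y in (0 : ℝ)..T, (0 : ℝ))) := by
      refine intervalIntegral.tendsto_integral_filter_of_dominated_convergence (fun _ => 1)
        (.of_forall fun m => (continuous_const.sub (hχc m)).aestronglyMeasurable)
        (.of_forall fun m => .of_forall fun y _ => ?_) (by simp) ?_
      · rw [Real.norm_of_nonneg (by linarith [hχ1 m y])]; linarith [hχ0 m y]
      · filter_upwards [hDc.ae_notMem MeasureTheory.volume] with y hy _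
        simpa using (hχlim y hy).const_sub 1
    simpa using this
  have hcomp : ∀ m y, ‖F y - F y * (χ m y : ℂ)‖ ≤ 1 - χ m y := by
    intro m y
    have : F y - F y * (χ m y : ℂ) = F y * ((1 - χ m y : ℝ) : ℂ) := by push_cast; ring
    rw [this, norm_mul, Complex.norm_real, Real.norm_of_nonneg (by linarith [hχ1 m y])]
    exact (mul_le_mul_of_nonneg_right (hF y) (by linarith [hχ1 m y])).trans (one_mul _).le
  rw [Metric.tendsto_nhds]
  intro ε hε
  obtain ⟨m, hm⟩ := ((hint.const_mul T⁻¹).eventually_lt_const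
    (u := ε / 4) (by simpa using by positivity)).exists
  set I : ℝ := T⁻¹ * ∫ y in (0 : ℝ)..T, (1 - χ m y) with hI
  have hI0 : 0 ≤ I := mul_nonneg (inv_nonneg.mpr hT.le)
    (intervalIntegral.integral_nonneg hT.le fun y _ => by linarith [hχ1 m y])
  have l1 := tendsto_avg_mul_of_continuous hT hv h (hcontF m)
    (fun y => by simp only [hper y, hχper m y])
  have l2 := tendsto_avg_mul_of_continuous hT (v := fun _ => 1) (V := 1) (by simp)
    (by simpa only [one_mul] using h₁)
    (G := fun y => ((1 - χ m y : ℝ) : ℂ))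
    (Complex.continuous_ofReal.comp (continuous_const.sub (hχc m)))
    (fun y => by simp only [hχper m y])
  simp only [one_mul] at l2
  rw [intervalIntegral.integral_ofReal, ← Complex.ofReal_inv, ← Complex.ofReal_mul] at l2
  have e2 : ∀ᶠ N in atTop, ‖avg (fun n => ((1 - χ m (x n) : ℝ) : ℂ)) N‖ < ε / 4 := by
    refine l2.norm.eventually_lt_const ?_
    rw [Complex.norm_real, Real.norm_of_nonneg hI0]; exact hm
  have h3 : ‖V * ((T : ℂ)⁻¹ * ∫ y in (0 : ℝ)..T, F y * (χ m y : ℂ))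
      - V * ((T : ℂ)⁻¹ * ∫ y in (0 : ℝ)..T, F y)‖ ≤ I := by
    have i1 : IntervalIntegrable F MeasureTheory.volume 0 T :=
      (intervalIntegrable_const (c := (1 : ℝ))).mono_fun hmeas.aestronglyMeasurable
        (.of_forall fun y => by simpa using hF y)
    rw [← mul_sub, ← mul_sub, ← intervalIntegral.integral_sub
      ((hcontF m).intervalIntegrable _ _) i1, norm_mul, norm_mul, norm_inv, Complex.norm_real,
      Real.norm_of_nonneg hT.le]
    have : ‖∫ y in (0 : ℝ)..T, (F y * (χ m y : ℂ) - F y)‖ ≤ ∫ y in (0 : ℝ)..T, (1 - χ m y) := by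
      refine intervalIntegral.norm_integral_le_of_norm_le hT.le
        (.of_forall fun y _ => by rw [norm_sub_rev]; exact hcomp m y)
        ((continuous_const.sub (hχc m)).intervalIntegrable _ _)
    calc ‖V‖ * (T⁻¹ * ‖∫ y in (0 : ℝ)..T, (F y * (χ m y : ℂ) - F y)‖)
        ≤ 1 * (T⁻¹ * ∫ y in (0 : ℝ)..T, (1 - χ m y)) := by gcongr
      _ = I := one_mul _
  filter_upwards [Metric.tendsto_nhds.mp l1 (ε / 4) (by positivity), e2] with N hN1 hN2
  rw [dist_eq_norm] at hN1 ⊢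
  have h1 : ‖avg (fun n => v n * F (x n)) N - avg (fun n => v n * (F (x n) * (χ m (x n) : ℂ))) N‖
      ≤ ‖avg (fun n => ((1 - χ m (x n) : ℝ) : ℂ)) N‖ := by
    rw [← avg_sub]
    refine norm_avg_le_avg (fun n => ?_) N
    rw [← mul_sub, norm_mul]
    exact (mul_le_mul (hv n) (hcomp m _) (norm_nonneg _) zero_le_one).trans (one_mul _).le
  have := norm_add₃_le
    (a := avg (fun n => v n * F (x n)) N - avg (fun n => v n * (F (x n) * (χ m (x n) : ℂ))) N)
    (b := avg (fun n => v n * (F (x n) * (χ m (x n) : ℂ))) N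
      - V * ((T : ℂ)⁻¹ * ∫ y in (0 : ℝ)..T, F y * (χ m y : ℂ)))
    (c := V * ((T : ℂ)⁻¹ * ∫ y in (0 : ℝ)..T, F y * (χ m y : ℂ))
      - V * ((T : ℂ)⁻¹ * ∫ y in (0 : ℝ)..T, F y))
  rw [sub_add_sub_cancel, sub_add_sub_cancel] at this
  linarith

theorem fwdDiff_iter_intCast (f : ℤ → ℤ) (d n : ℕ) :
    (fwdDiff 1)^[d] (fun n : ℕ => ((f n : ℤ) : ℝ)) n = (((fwdDiff 1)^[d] f n : ℤ) : ℝ) := by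
  induction d generalizing f with
  | zero => rfl
  | succ d ih =>
    rw [Function.iterate_succ_apply, Function.iterate_succ_apply, ← ih]
    refine congrFun (congrArg _ (funext fun m => ?_)) n
    simp [fwdDiff]

theorem fwdDiff_iter_affine (B C : ℝ) (d n : ℕ) :
    (fwdDiff 1)^[d + 1] (fun n : ℕ => B + C * n) n = if d = 0 then C else 0 := by
  have h1 : fwdDiff 1 (fun n : ℕ => B + C * n) = fun _ => C := by
    funext n; simp [fwdDiff]; ring
  rw [Function.iterate_succ_apply, h1]
  cases d with
  | zero => simp
  | succ d =>
    rw [Function.iterate_succ_apply, fwdDiff_const, if_neg (Nat.succ_ne_zero d)]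
    have := congrFun (fwdDiff_iter_const_smul (1 : ℕ) (0 : ℝ) (fun _ : ℕ => (0 : ℝ)) d) n
    rw [zero_smul, zero_smul] at this
    exact this

theorem tendsto_avg_e_polynomial {P : Polynomial ℤ} (hP : 0 < P.natDegree) {A : ℝ}
    (hA : Irrational A) (B : ℝ) (C : ℚ) :
    Tendsto (avg fun n => e (A * ((P.eval (n : ℤ) : ℤ) : ℝ) + (B + C * n))) atTop (nhds 0) := by
  obtain ⟨d, hd⟩ := Nat.exists_eq_succ_of_ne_zero hP.ne'
  have hlead : P.leadingCoeff * ((d + 1).factorial : ℤ) ≠ 0 :=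
    mul_ne_zero (Polynomial.leadingCoeff_ne_zero.mpr fun h => by simp [h] at hP)
      (by exact_mod_cast (Nat.factorial_pos _).ne')
  have hval : ∀ n : ℕ,
      (fwdDiff 1)^[d + 1] (fun n : ℕ => A * ((P.eval (n : ℤ) : ℤ) : ℝ) + (B + C * n)) n
        = A * (P.leadingCoeff * ((d + 1).factorial : ℤ) : ℤ)
          + ((if d = 0 then C else 0 : ℚ) : ℝ) := by
    intro n
    have h1 : (fun n : ℕ => A * ((P.eval (n : ℤ) : ℤ) : ℝ) + (B + C * n))
        = (A • fun n : ℕ => ((P.eval (n : ℤ) : ℤ) : ℝ)) + fun n : ℕ => B + C * n := rfl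
    rw [h1, fwdDiff_iter_add, fwdDiff_iter_const_smul, Pi.add_apply, Pi.smul_apply,
      fwdDiff_iter_intCast fun z => P.eval z, fwdDiff_iter_affine]
    have h2 := P.fwdDiff_iter_degree_eq_factorial
    rw [hd] at h2
    rw [h2]
    split_ifs <;> simp
  exact tendsto_avg_e_of_fwdDiff_iter d _ _ ((hA.mul_intCast hlead).add_ratCast _) hval

/-- The indicator of a residue class. -/
def residueIndicator (K j n : ℕ) : ℂ := if n ≡ j [MOD K] then 1 else 0

theorem residueIndicator_eq_sum {K : ℕ} (hK : 0 < K) (j n : ℕ) :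
    residueIndicator K j n
      = ∑ h ∈ Finset.range K, (K : ℂ)⁻¹ * e (-(h * j / K)) * e (h * n / K) := by
  have hK' : (K : ℝ) ≠ 0 := by exact_mod_cast hK.ne'
  have hKc : (K : ℂ) ≠ 0 := by exact_mod_cast hK.ne'
  set z := e (((n : ℝ) - j) / K) with hz
  have h1 : ∀ h : ℕ, (K : ℂ)⁻¹ * e (-(h * j / K)) * e (h * n / K) = (K : ℂ)⁻¹ * z ^ h := by
    intro h
    rw [hz, ← e_natCast_mul, mul_assoc, ← e_add]
    congr 2; ring
  have hzK : z ^ K = 1 := by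
    rw [hz, ← e_natCast_mul, mul_div_cancel₀ _ hK']
    simpa using e_int (n - j)
  simp only [h1, ← Finset.mul_sum]
  have hiff : n ≡ j [MOD K] ↔ z = 1 := by
    rw [hz, e_eq_one_iff, Nat.ModEq.comm, Nat.modEq_iff_dvd]
    constructor
    · rintro ⟨m, hm⟩
      refine ⟨m, ?_⟩
      rw [div_eq_iff hK', mul_comm]
      exact_mod_cast hm
    · rintro ⟨m, hm⟩
      refine ⟨m, ?_⟩
      rw [div_eq_iff hK', mul_comm] at hm
      exact_mod_cast hm
  rw [residueIndicator]
  split_ifs with hn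
  · rw [hiff.mp hn]; simp [hKc]
  · rw [geom_sum_eq fun hz1 => hn (hiff.mpr hz1), hzK]; simp

theorem norm_residueIndicator_le (K j n : ℕ) : ‖residueIndicator K j n‖ ≤ 1 := by
  rw [residueIndicator]; split_ifs <;> simp

theorem sum_residueIndicator {K : ℕ} (hK : 0 < K) (n : ℕ) :
    ∑ j ∈ Finset.Icc 1 K, residueIndicator K j n = 1 := by
  have hj : (n + (K - 1)) % K + 1 ≡ n [MOD K] := by
    have : (n + (K - 1)) % K + 1 ≡ n + (K - 1) + 1 [MOD K] := (Nat.mod_modEq _ _).add_right 1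
    rw [show n + (K - 1) + 1 = n + K by omega] at this
    exact this.trans (by simp)
  have hlt := Nat.mod_lt (n + (K - 1)) hK
  rw [Finset.sum_eq_single ((n + (K - 1)) % K + 1)]
  · rw [residueIndicator, if_pos hj.symm]
  · intro j hjm hne
    rw [residueIndicator, if_neg]
    intro h
    rw [Finset.mem_Icc] at hjm
    obtain ⟨i, rfl⟩ : ∃ i, j = i + 1 := ⟨j - 1, by omega⟩
    have := Nat.ModEq.add_right_cancel' 1 (hj.trans h)
    exact hne (by rw [this.eq_of_lt_of_lt hlt (by omega)])
  · intro h
    exact absurd (Finset.mem_Icc.mpr ⟨by omega, by omega⟩) h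

theorem tendsto_avg_residueIndicator_mul_e {P : Polynomial ℤ} (hP : 0 < P.natDegree) {A : ℝ}
    (hA : Irrational A) (B : ℝ) {K : ℕ} (hK : 0 < K) (j : ℕ) (m : ℤ) :
    Tendsto (avg fun n => residueIndicator K j n *
        e (m * (A * ((P.eval (n : ℤ) : ℤ) : ℝ) + B) / K)) atTop
      (nhds (if m = 0 then (K : ℂ)⁻¹ else 0)) := by
  have hK' : (K : ℝ) ≠ 0 := by exact_mod_cast hK.ne'
  have hterm : ∀ h ∈ Finset.range K, Tendsto (avg fun n => e (h * n / K) *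
      e (m * (A * ((P.eval (n : ℤ) : ℤ) : ℝ) + B) / K)) atTop
      (nhds (if m = 0 ∧ h = 0 then 1 else 0)) := by
    intro h hh
    by_cases hm : m = 0
    · subst hm
      by_cases h0 : h = 0
      · subst h0
        simpa [e_zero] using tendsto_avg_const 1
      · rw [if_neg (by simp [h0])]
        have hne : e ((h : ℝ) / K) ≠ 1 := by
          rw [Ne, e_eq_one_iff]
          rintro ⟨i, hi⟩
          rw [div_eq_iff hK'] at hi
          have hi' : (h : ℤ) = i * K := by exact_mod_cast hi
          have h1 := Int.le_of_dvd (by omega) (Dvd.intro_left i hi'.symm)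
          have := Finset.mem_range.mp hh
          omega
        refine (tendsto_avg_pow (norm_e _) hne).congr fun N => ?_
        congr 1; funext n
        rw [← e_natCast_mul]
        simp only [Int.cast_zero, zero_mul, zero_div, e_zero, mul_one]
        congr 1; ring
    · rw [if_neg (by simp [hm])]
      have hA' : Irrational (A * (m / K : ℚ)) :=
        hA.mul_ratCast (div_ne_zero (by exact_mod_cast hm) (by exact_mod_cast hK.ne'))
      refine (tendsto_avg_e_polynomial hP hA' (m * B / K) (h / K : ℚ)).congr fun N => ?_
      congr 1; funext n
      rw [← e_add]
      congr 1; push_cast; ring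
  have hsum := tendsto_finsetSum (Finset.range K) fun h hh =>
    (hterm h hh).const_mul ((K : ℂ)⁻¹ * e (-(h * j / K)))
  have hlim : ∑ h ∈ Finset.range K, (K : ℂ)⁻¹ * e (-(h * j / K)) *
      (if m = 0 ∧ h = 0 then 1 else 0) = if m = 0 then (K : ℂ)⁻¹ else 0 := by
    by_cases hm : m = 0
    · rw [Finset.sum_eq_single 0] <;> simp +contextual [hm, e_zero, hK.ne']
    · simp [hm]
  rw [hlim] at hsum
  refine hsum.congr fun N => ?_
  simp only [← avg_const_mul, ← avg_finsetSum]
  congr 1; funext n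
  rw [residueIndicator_eq_sum hK, Finset.sum_mul]
  exact Finset.sum_congr rfl fun h _ => by ring

/-- Joint equidistribution of a polynomial sequence and of its index modulo `K`. -/
theorem tendsto_avg_of_residues {P : Polynomial ℤ} (hP : 0 < P.natDegree) {A : ℝ}
    (hA : Irrational A) (B : ℝ) {K : ℕ} (hK : 0 < K) {x : ℕ → ℝ}
    (hx : ∀ n : ℕ, x n = A * ((P.eval (n : ℤ) : ℤ) : ℝ) + B) {F : ℕ → ℝ → ℂ}
    (hper : ∀ j, Function.Periodic (F j) K) (hF : ∀ j y, ‖F j y‖ ≤ 1)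
    (hmeas : ∀ j, Measurable (F j))
    {D : ℕ → Set ℝ} (hD : ∀ j, IsClosed (D j)) (hDne : ∀ j, (D j).Nonempty)
    (hDc : ∀ j, (D j).Countable) (hDT : ∀ j (y : ℝ), y + K ∈ D j ↔ y ∈ D j)
    (hcont : ∀ j, ∀ y ∉ D j, ContinuousAt (F j) y) {g : ℕ → ℂ}
    (hg : ∀ n j, n ≡ j [MOD K] → g n = F j (x n)) :
    Tendsto (avg g) atTop (nhds ((K : ℂ)⁻¹ * ∑ j ∈ Finset.Icc 1 K,
      ((K : ℂ)⁻¹ * ∫ y in (0 : ℝ)..K, F j y))) := by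
  have hKr : (0 : ℝ) < K := by exact_mod_cast hK
  have h₁ : ∀ m : ℤ, Tendsto (avg fun n => e (m * x n / K)) atTop
      (nhds (if m = 0 then 1 else 0)) := by
    intro m
    have := tendsto_finsetSum (Finset.Icc 1 K) fun j _ =>
      tendsto_avg_residueIndicator_mul_e hP hA B hK j m
    have hlim : ∑ _j ∈ Finset.Icc 1 K, (if m = 0 then (K : ℂ)⁻¹ else 0)
        = if m = 0 then 1 else 0 := by
      have hKc : (K : ℂ) ≠ 0 := by exact_mod_cast hK.ne'
      split_ifs <;> simp [hKc]
    rw [hlim] at this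
    refine this.congr fun N => ?_
    simp only [← avg_finsetSum, ← Finset.sum_mul, sum_residueIndicator hK, one_mul, hx]
  have := tendsto_finsetSum (Finset.Icc 1 K) fun j _ =>
    tendsto_avg_mul_of_continuousAt hKr (norm_residueIndicator_le K j)
      (fun m => by simpa only [hx] using tendsto_avg_residueIndicator_mul_e hP hA B hK j m) h₁
      (hper j) (hF j) (hmeas j) (hD j) (hDne j) (hDc j) (hDT j) (hcont j)
  rw [Finset.mul_sum]
  refine this.congr fun N => ?_
  rw [← avg_finsetSum]
  congr 1; funext n
  rw [← one_mul (g n), ← sum_residueIndicator hK n, Finset.sum_mul]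
  refine Finset.sum_congr rfl fun j _ => ?_
  rw [residueIndicator]
  split_ifs with h
  · rw [hg n j h]
  · simp

/-- The phase of the averaged exponential, as a function of the value `y` of the polynomial
and of the orbit point `x`. -/
def phase (k l : ℤ) (q r u t s y x : ℝ) : ℝ :=
  q * x + r * ((y - l * x) / k - u) - Int.fract x * t + Int.fract ((y - l * x) / k) * s

theorem sgn_mul_self (k : ℤ) : sgn k * sgn k = 1 := by
  unfold sgn; split_ifs <;> norm_num

theorem sgn_mul_abs (k : ℤ) : sgn k * |(k : ℝ)| = k := by
  unfold sgn; split_ifs with h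
  · rw [abs_of_neg (by exact_mod_cast h)]; ring
  · rw [abs_of_nonneg (by exact_mod_cast not_lt.mp h)]; ring

theorem exists_int_eq_sgn (k : ℤ) : ∃ m : ℤ, sgn k = m := by
  unfold sgn; split_ifs
  · exact ⟨-1, by simp⟩
  · exact ⟨1, by simp⟩

theorem cast_natAbs_mul (c : ℕ) (k : ℤ) : ((((c : ℤ) * k).natAbs : ℕ) : ℝ) = c * k * sgn k := by
  rw [Nat.cast_natAbs, Int.cast_abs]
  push_cast
  rw [abs_mul, Nat.abs_cast, mul_assoc, ← sgn_mul_abs k, mul_comm _ (sgn k), ← mul_assoc (sgn k),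
    sgn_mul_self, one_mul, sgn_mul_abs]

theorem e_eq_of_sub_int {x y : ℝ} {m : ℤ} (h : x = y + m) : e x = e y := by
  rw [h, e_add, e_int, mul_one]

theorem measurable_phase (k l : ℤ) (q r u t s y : ℝ) : Measurable (phase k l q r u t s y) := by
  unfold phase
  refine Measurable.add (Measurable.sub (by fun_prop) ?_) ?_
  · exact measurable_fract.mul_const t
  · exact (measurable_fract.comp (by fun_prop)).mul_const s

theorem e_phase_periodic {c : ℕ} (hc : 1 ≤ c) {k l : ℤ} (hk : k ≠ 0) {q r : ℝ}
    (hq : ∃ m : ℤ, q = (m : ℝ) / (c : ℝ)) (hr : ∃ m : ℤ, r = (m : ℝ) / (c : ℝ)) (u t s y : ℝ) :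
    Function.Periodic (fun x => e (phase k l q r u t s y x)) ((((c : ℤ) * k).natAbs : ℕ) : ℝ) := by
  obtain ⟨a, rfl⟩ := hq
  obtain ⟨b, rfl⟩ := hr
  obtain ⟨σ, hσ⟩ := exists_int_eq_sgn k
  have hc' : (c : ℝ) ≠ 0 := by exact_mod_cast (by omega : c ≠ 0)
  have hk' : (k : ℝ) ≠ 0 := by exact_mod_cast hk
  intro x
  rw [cast_natAbs_mul, hσ]
  refine e_eq_of_sub_int (m := a * k * σ - b * l * σ) ?_
  have h1 : Int.fract (x + c * k * σ) = Int.fract x := by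
    have := Int.fract_add_intCast x (c * k * σ)
    push_cast at this; exact this
  have h2 : (y - l * (x + c * k * σ)) / k = (y - l * x) / k - ((l * c * σ : ℤ) : ℝ) := by
    push_cast; field_simp; ring
  rw [phase, phase, h1, h2, Int.fract_sub_intCast]
  push_cast; field_simp; ring

theorem e_phase_congr {c : ℕ} (hc : 1 ≤ c) {k l : ℤ} (hk : k ≠ 0) {r : ℝ}
    (hr : ∃ m : ℤ, r = (m : ℝ) / (c : ℝ)) (q u t s y x : ℝ) (z : ℤ) :
    e (phase k l q r u t s (y + c * k * z) x) = e (phase k l q r u t s y x) := by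
  obtain ⟨b, rfl⟩ := hr
  have hc' : (c : ℝ) ≠ 0 := by exact_mod_cast (by omega : c ≠ 0)
  have hk' : (k : ℝ) ≠ 0 := by exact_mod_cast hk
  refine e_eq_of_sub_int (m := b * z) ?_
  have h2 : (y + c * k * z - l * x) / k = (y - l * x) / k + ((c * z : ℤ) : ℝ) := by
    push_cast; field_simp; ring
  rw [phase, phase, h2, Int.fract_add_intCast]
  push_cast; field_simp; ring

/-- The points where the phase may be discontinuous. -/
def phaseSingularities (k l : ℤ) (y : ℝ) : Set ℝ :=
  Set.range ((↑) : ℤ → ℝ) ∪ (fun x : ℝ => (y - l * x) / k) ⁻¹' Set.range ((↑) : ℤ → ℝ)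

theorem isClosed_phaseSingularities (k l : ℤ) (y : ℝ) : IsClosed (phaseSingularities k l y) := by
  have h := Int.isClosedEmbedding_coe_real.isClosed_range
  exact h.union (h.preimage (by fun_prop))

theorem nonempty_phaseSingularities (k l : ℤ) (y : ℝ) : (phaseSingularities k l y).Nonempty :=
  ⟨0, Or.inl ⟨0, by simp⟩⟩

theorem countable_phaseSingularities {k l : ℤ} (hk : k ≠ 0) (hl : l ≠ 0) (y : ℝ) :
    (phaseSingularities k l y).Countable := by
  refine (Set.countable_range _).union ((Set.countable_range _).preimage_of_injOn ?_)
  have hk' : (k : ℝ) ≠ 0 := by exact_mod_cast hk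
  have hl' : (l : ℝ) ≠ 0 := by exact_mod_cast hl
  intro x _ x' _ h
  simpa [div_left_inj' hk', hl'] using h

theorem add_mem_phaseSingularities_iff (c : ℕ) {k : ℤ} (hk : k ≠ 0) (l : ℤ) (y x : ℝ) :
    x + ((((c : ℤ) * k).natAbs : ℕ) : ℝ) ∈ phaseSingularities k l y ↔
      x ∈ phaseSingularities k l y := by
  obtain ⟨σ, hσ⟩ := exists_int_eq_sgn k
  have hk' : (k : ℝ) ≠ 0 := by exact_mod_cast hk
  rw [cast_natAbs_mul, hσ]
  have h1 : x + c * k * σ = x + ((c * k * σ : ℤ) : ℝ) := by push_cast; rfl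
  have h2 : (y - l * (x + c * k * σ)) / k = (y - l * x) / k - ((l * c * σ : ℤ) : ℝ) := by
    push_cast; field_simp; ring
  have hadd : ∀ (z : ℝ) (m : ℤ), z + m ∈ Set.range ((↑) : ℤ → ℝ) ↔ z ∈ Set.range ((↑) : ℤ → ℝ) := by
    intro z m
    constructor
    · rintro ⟨i, hi⟩; exact ⟨i - m, by push_cast; linarith⟩
    · rintro ⟨i, hi⟩; exact ⟨i + m, by push_cast; linarith⟩
  simp only [phaseSingularities, Set.mem_union, Set.mem_preimage]
  rw [h2, h1, hadd, sub_eq_add_neg, ← Int.cast_neg, hadd]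

theorem continuousAt_e_phase (k l : ℤ) (q r u t s y : ℝ) {x : ℝ}
    (hx : x ∉ phaseSingularities k l y) :
    ContinuousAt (fun x => e (phase k l q r u t s y x)) x := by
  have hfract : ∀ z : ℝ, z ∉ Set.range ((↑) : ℤ → ℝ) → ContinuousAt (Int.fract : ℝ → ℝ) z := by
    intro z hz
    refine continuousAt_fract fun h => hz ⟨⌊z⌋, h.symm⟩
  simp only [phaseSingularities, Set.mem_union, Set.mem_preimage, not_or] at hx
  refine continuous_e.continuousAt.comp ?_
  unfold phase
  refine ContinuousAt.add (ContinuousAt.sub (by fun_prop) ?_) ?_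
  · exact (hfract x hx.1).mul continuousAt_const
  · refine ContinuousAt.mul ?_ continuousAt_const
    exact ContinuousAt.comp (f := fun x : ℝ => (y - l * x) / k) (hfract _ hx.2) (by fun_prop)

theorem floor_add_div_of_mem_Ico {l : ℤ} (hl : 1 ≤ l) (N : ℤ) {v : ℝ} (h0 : 0 ≤ v) (h1 : v < 1) :
    ⌊((N : ℝ) + v) / l⌋ = ⌊(N : ℝ) / l⌋ := by
  have hl' : (0 : ℝ) < l := by exact_mod_cast (by omega : 0 < l)
  have ha := Int.floor_le ((N : ℝ) / l)
  have hb := Int.lt_floor_add_one ((N : ℝ) / l)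
  rw [Int.floor_eq_iff]
  set f := ⌊(N : ℝ) / l⌋
  rw [le_div_iff₀ hl'] at ha ⊢
  rw [div_lt_iff₀ hl'] at hb ⊢
  have hb' : N + 1 ≤ (f + 1) * l := by exact_mod_cast hb
  have hb'' : (N : ℝ) + 1 ≤ (f + 1) * l := by exact_mod_cast hb'
  constructor <;> linarith

theorem floor_sgn_mul_div {l : ℤ} (hl : 1 ≤ l) (k : ℤ) (i : ℕ) {v : ℝ} (h0 : 0 < v) (h1 : v < 1) :
    ⌊sgn k * (i + v) / l⌋ = ⌊sgn k * ((i : ℝ) + indNeg k) / l⌋ := by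
  unfold sgn indNeg
  split_ifs with h
  · have := floor_add_div_of_mem_Ico hl (-(i + 1)) (v := 1 - v) (by linarith) (by linarith)
    push_cast at this
    convert this using 3 <;> ring
  · have := floor_add_div_of_mem_Ico hl i h0.le h1
    push_cast at this
    simpa using this

theorem floor_sub_div_abs {k : ℤ} (hk : k ≠ 0) (z : ℝ) {v : ℝ} (h0 : 0 < v) (h1 : v < 1) :
    ⌊z - v / |(k : ℝ)|⌋ = if v ≤ |(k : ℝ)| * Int.fract z then ⌊z⌋ else ⌊z⌋ - 1 := by
  have hk1 : (1 : ℝ) ≤ |(k : ℝ)| := by exact_mod_cast Int.one_le_abs hk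
  have hk0 : 0 < |(k : ℝ)| := by linarith
  have hz := Int.self_sub_floor z
  have hz0 := Int.fract_nonneg z
  have hz1 := Int.fract_lt_one z
  have hv : 0 < v / |(k : ℝ)| := by positivity
  have hv1 : v / |(k : ℝ)| < 1 := by rw [div_lt_one hk0]; linarith
  split_ifs with h
  · rw [mul_comm, ← div_le_iff₀ hk0] at h
    rw [Int.floor_eq_iff]
    constructor <;> linarith
  · rw [mul_comm, ← div_le_iff₀ hk0] at h
    rw [Int.floor_eq_iff]
    push_cast
    constructor <;> linarith

/-- The phase on a cell of length `1 / l`. -/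
theorem phase_cell {k l : ℤ} (hk : k ≠ 0) (hl : 1 ≤ l) (q r u t s : ℝ) (p : ℕ → ℝ) (j i : ℕ)
    {v : ℝ} (h0 : 0 < v) (h1 : v < 1) :
    phase k l q r u t s (p j) (sgn k * (i + v) / l) =
      -(r * u) + (r + s) * p j / k + (i * wval k l q r t s + bval p k l t s j i)
        + v * wval k l q r t s + if v ≤ xval p k j i then 0 else s := by
  have hk' : (k : ℝ) ≠ 0 := by exact_mod_cast hk
  have hl' : (0 : ℝ) < l := by exact_mod_cast (by omega : 0 < l)
  have hka : |(k : ℝ)| ≠ 0 := abs_ne_zero.mpr hk'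
  have hσ : sgn k / k = 1 / |(k : ℝ)| := by
    rw [div_eq_div_iff hk' hka, sgn_mul_abs, one_mul]
  have hz : (p j - l * (sgn k * (i + v) / l)) / k = (p j - sgn k * i) / k - v / |(k : ℝ)| := by
    rw [mul_div_cancel₀ _ hl'.ne', show v / |(k : ℝ)| = v * (1 / |(k : ℝ)|) by ring, ← hσ]
    ring
  have hw : (i + v) * wval k l q r t s
      = (sgn k * (i + v) / l) * (q - t) - (r + s) * ((i + v) * (sgn k / k)) := by
    rw [wval, abs_mul, abs_of_pos hl', hσ]
    have : sgn k = k / |(k : ℝ)| := by rw [eq_div_iff hka, sgn_mul_abs]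
    rw [this]
    field_simp
  have hf := floor_sub_div_abs hk ((p j - sgn k * i) / k) h0 h1
  rw [phase, hz]
  simp only [← Int.self_sub_floor]
  rw [floor_sgn_mul_div hl k i h0 h1, hf, bval, xval]
  have hexp : i * wval k l q r t s = (i + v) * wval k l q r t s - v * wval k l q r t s := by ring
  have hv : v / |(k : ℝ)| = v * (sgn k / k) := by rw [hσ]; ring
  rw [hexp, hw, hv]
  split_ifs <;> push_cast <;> ring

theorem integral_e_mul {w : ℝ} (hw : w ≠ 0) (a b : ℝ) :
    ∫ v in a..b, e (v * w) = (2 * (Real.pi : ℂ) * Complex.I * w)⁻¹ * (e (w * b) - e (w * a)) := by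
  have hc : (2 * (Real.pi : ℂ) * Complex.I * w) ≠ 0 := by
    simp [Real.pi_ne_zero, hw]
  have h1 : ∀ v : ℝ, e (v * w) = Complex.exp ((2 * (Real.pi : ℂ) * Complex.I * w) * v) := by
    intro v; rw [e]; congr 1; push_cast; ring
  simp only [h1, mul_comm w]
  rw [integral_exp_mul_complex hc]
  ring

/-- The integral over a cell, before evaluation of the two exponential integrals. -/
theorem integral_e_phase_cell {k l : ℤ} (hk : k ≠ 0) (hl : 1 ≤ l) (q r u t s : ℝ) (p : ℕ → ℝ)
    (j i : ℕ) :
    ∫ v in (0 : ℝ)..1, e (phase k l q r u t s (p j) (sgn k * (i + v) / l)) =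
      e (-(r * u)) * (e ((r + s) * p j / k) *
        (e (i * wval k l q r t s + bval p k l t s j i) *
          ((∫ v in (0 : ℝ)..(min (xval p k j i) 1), e (v * wval k l q r t s))
            + e s * ∫ v in (min (xval p k j i) 1)..1, e (v * wval k l q r t s)))) := by
  set m := min (xval p k j i) 1 with hm
  set C := e (-(r * u) + (r + s) * p j / k + (i * wval k l q r t s + bval p k l t s j i)) with hC
  have hx0 : 0 ≤ xval p k j i := mul_nonneg (abs_nonneg _) (Int.fract_nonneg _)
  have hm0 : 0 ≤ m := le_min hx0 zero_le_one
  have hm1 : m ≤ 1 := min_le_right _ _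
  have hmeas : Measurable fun v : ℝ => e (phase k l q r u t s (p j) (sgn k * (i + v) / l)) :=
    continuous_e.measurable.comp ((measurable_phase k l q r u t s (p j)).comp (by fun_prop))
  have hii : ∀ a b : ℝ, IntervalIntegrable
      (fun v : ℝ => e (phase k l q r u t s (p j) (sgn k * (i + v) / l)))
      MeasureTheory.volume a b := fun a b =>
    (intervalIntegrable_const (c := (1 : ℝ))).mono_fun hmeas.aestronglyMeasurable
      (.of_forall fun y => by simp [norm_e])
  have hA : ∫ v in (0 : ℝ)..m, e (phase k l q r u t s (p j) (sgn k * (i + v) / l))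
      = C * ∫ v in (0 : ℝ)..m, e (v * wval k l q r t s) := by
    rw [← intervalIntegral.integral_const_mul]
    refine intervalIntegral.integral_congr_uIoo fun v hv => ?_
    rw [Set.uIoo_of_le hm0] at hv
    rw [phase_cell hk hl q r u t s p j i hv.1 (hv.2.trans_le hm1),
      if_pos (hv.2.le.trans (min_le_left _ _)), add_zero, e_add]
  have hB : ∫ v in m..1, e (phase k l q r u t s (p j) (sgn k * (i + v) / l))
      = C * (e s * ∫ v in m..1, e (v * wval k l q r t s)) := by
    rw [← intervalIntegral.integral_const_mul, ← intervalIntegral.integral_const_mul]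
    refine intervalIntegral.integral_congr_uIoo fun v hv => ?_
    rw [Set.uIoo_of_le hm1] at hv
    have hnot : ¬ v ≤ xval p k j i := fun h => absurd hv.1 (not_lt.mpr (le_min h hv.2.le))
    rw [phase_cell hk hl q r u t s p j i (hm0.trans_lt hv.1) hv.2, if_neg hnot, e_add, e_add]
    ring
  rw [← intervalIntegral.integral_add_adjacent_intervals (hii 0 m) (hii m 1), hA, hB, hC,
    e_add, e_add]
  ring

/-- A mean over a period, split into cells of length `1 / l`. -/
theorem mean_eq_sum_cells {F : ℝ → ℂ} {K M : ℕ} {l : ℤ} (hl : 1 ≤ l) (hM : (M : ℝ) = K * l) (k : ℤ)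
    (hper : Function.Periodic F K) (hmeas : Measurable F) (hF : ∀ x, ‖F x‖ ≤ 1) :
    (K : ℂ)⁻¹ * ∫ x in (0 : ℝ)..K, F x =
      (M : ℂ)⁻¹ * ∑ i ∈ Finset.range M, ∫ v in (0 : ℝ)..1, F (sgn k * (i + v) / l) := by
  have hl' : (l : ℝ) ≠ 0 := by exact_mod_cast (by omega : l ≠ 0)
  have hlc : (l : ℂ) ≠ 0 := by exact_mod_cast (by omega : l ≠ 0)
  have hmeas' : Measurable fun y : ℝ => F (sgn k * y / l) := hmeas.comp (by fun_prop)
  have hii : ∀ a b : ℝ, IntervalIntegrable (fun y : ℝ => F (sgn k * y / l))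
      MeasureTheory.volume a b := fun a b =>
    (intervalIntegrable_const (c := (1 : ℝ))).mono_fun hmeas'.aestronglyMeasurable
      (.of_forall fun y => by simpa using hF _)
  have hsgn : ∫ x in (0 : ℝ)..K, F (sgn k * x) = ∫ x in (0 : ℝ)..K, F x := by
    unfold sgn
    split_ifs
    · simp only [neg_one_mul]
      rw [intervalIntegral.integral_comp_neg fun x => F x]
      have := hper.intervalIntegral_add_eq (-(K : ℝ)) 0
      simpa using this
    · simp
  have hscale : ∫ y in (0 : ℝ)..M, F (sgn k * y / l) = l * ∫ x in (0 : ℝ)..K, F x := by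
    have := intervalIntegral.integral_comp_div (a := 0) (b := M) (fun x => F (sgn k * x)) hl'
    rw [hM, zero_div, mul_div_cancel_right₀ _ hl', hsgn] at this
    rw [hM]
    simpa [mul_div_assoc] using this
  have hcells : ∑ i ∈ Finset.range M, ∫ v in (0 : ℝ)..1, F (sgn k * (i + v) / l)
      = ∫ y in (0 : ℝ)..M, F (sgn k * y / l) := by
    have := intervalIntegral.sum_integral_adjacent_intervals (a := fun i : ℕ => (i : ℝ)) (n := M)
      (f := fun y : ℝ => F (sgn k * y / l)) fun i _ => hii _ _
    rw [Nat.cast_zero] at this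
    rw [← this]
    refine Finset.sum_congr rfl fun i _ => ?_
    rw [intervalIntegral.integral_comp_add_left (fun y => F (sgn k * y / l))]
    simp
  have hMc : (M : ℂ) = K * l := by exact_mod_cast congrArg ((↑) : ℝ → ℂ) hM
  rw [hcells, hscale, hMc, mul_inv]
  field_simp

/-- Let `β` be irrational, `c ≥ 1`, `k ∈ ℤ∖{0}`, `l ≥ 1`,
`q, r ∈ (1/c)·ℤ`, `p(x) = P(x) + ρ` with `P ∈ ℤ[x]` nonconstant, and
`a(n) = (p(n) − ku)/(kβ + l)`. Then the averages
`(1/N)·Σ e(q·a(n) + βr·a(n) − {a(n)}t + {βa(n)+u}s)` tend to `0` if and only if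
condition (i) (`w = 0` case) or condition (ii) (`w ≠ 0` case) holds. -/
theorem stmt10 (β : ℝ) (hβ : Irrational β) (u t s : ℝ) (c : ℕ) (hc : 1 ≤ c)
    (k : ℤ) (hk : k ≠ 0) (l : ℤ) (hl : 1 ≤ l) (q r : ℝ)
    (hq : ∃ m : ℤ, q = (m : ℝ) / (c : ℝ)) (hr : ∃ m : ℤ, r = (m : ℝ) / (c : ℝ))
    (P : Polynomial ℤ) (hP : 0 < P.natDegree) (ρ : ℝ)
    (p : ℕ → ℝ) (hp : ∀ n, p n = ((P.eval (n : ℤ) : ℤ) : ℝ) + ρ)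
    (a : ℕ → ℝ) (ha : ∀ n, a n = (p n - (k : ℝ) * u) / ((k : ℝ) * β + (l : ℝ))) :
    Tendsto (fun N : ℕ => (N : ℂ)⁻¹ * ∑ n ∈ Finset.Icc 1 N,
        e (q * a n + β * r * a n - Int.fract (a n) * t + Int.fract (β * a n + u) * s))
      atTop (nhds 0) ↔
    ((wval k l q r t s = 0 ∧
        (((((c : ℤ) * k).natAbs : ℕ) : ℂ)⁻¹ * ∑ j ∈ Finset.Icc 1 ((c : ℤ) * k).natAbs,
          e ((r + s) * p j / (k : ℝ)) *
            ((((((c : ℤ) * k * l).natAbs : ℕ) : ℂ))⁻¹ *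
              ∑ j' ∈ Finset.range ((c : ℤ) * k * l).natAbs,
                e (bval p k l t s j j') *
                  (e s + ((min (xval p k j j') 1 : ℝ) : ℂ) * (1 - e s))) = 0)) ∨
      (wval k l q r t s ≠ 0 ∧
        (((((c : ℤ) * k).natAbs : ℕ) : ℂ)⁻¹ * ∑ j ∈ Finset.Icc 1 ((c : ℤ) * k).natAbs,
          e ((r + s) * p j / (k : ℝ)) *
            ((((((c : ℤ) * k * l).natAbs : ℕ) : ℂ))⁻¹ *
              ∑ j' ∈ Finset.range ((c : ℤ) * k * l).natAbs,
                e ((j' : ℝ) * wval k l q r t s + bval p k l t s j j') *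
                  (e s * (e (wval k l q r t s) - 1) +
                    (1 - e s) *
                      (e (wval k l q r t s * min (xval p k j j') 1) - 1))) = 0))) := by
  have hl0 : l ≠ 0 := by omega
  have hk' : (k : ℝ) ≠ 0 := by exact_mod_cast hk
  set w := wval k l q r t s with hw
  set K := ((c : ℤ) * k).natAbs with hKdef
  set M := ((c : ℤ) * k * l).natAbs with hMdef
  have hK : 0 < K := Int.natAbs_pos.mpr (mul_ne_zero (by omega) hk)
  have hMK : (M : ℝ) = K * l := by
    rw [hMdef, Int.natAbs_mul, ← hKdef, Nat.cast_mul, Nat.cast_natAbs l,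
      abs_of_pos (by omega)]
  have hden : Irrational ((k : ℝ) * β + l) := (hβ.intCast_mul hk).add_intCast l
  have hA : Irrational ((k : ℝ) * β + l)⁻¹ := hden.inv
  have hden0 : (k : ℝ) * β + l ≠ 0 := hden.ne_zero
  have hax : ∀ n : ℕ, a n = ((k : ℝ) * β + l)⁻¹ * ((P.eval (n : ℤ) : ℤ) : ℝ)
      + (ρ - k * u) / (k * β + l) := by
    intro n; rw [ha, hp]; field_simp; ring
  set g : ℕ → ℂ := fun n =>
    e (q * a n + β * r * a n - Int.fract (a n) * t + Int.fract (β * a n + u) * s) with hg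
  have hgphase : ∀ n, g n = e (phase k l q r u t s (p n) (a n)) := by
    intro n
    have h1 : β * a n = (p n - l * a n) / k - u := by
      have hD : (k * β + l) * a n = p n - k * u := by rw [ha]; field_simp
      rw [eq_sub_iff_add_eq, eq_div_iff hk']; linarith
    simp only [hg, phase]
    rw [mul_right_comm, h1, sub_add_cancel]
    congr 1; ring
  have hgres : ∀ n j, n ≡ j [MOD K] → g n = e (phase k l q r u t s (p j) (a n)) := by
    intro n j hnj
    have hdvd : (c : ℤ) * k ∣ P.eval (n : ℤ) - P.eval (j : ℤ) :=
      (Int.natAbs_dvd.mp ((Nat.modEq_iff_dvd.mp hnj.symm))).trans (Polynomial.sub_dvd_eval_sub _ _ P)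
    obtain ⟨z, hz⟩ := hdvd
    have hpn : p n = p j + c * k * z := by
      have : ((P.eval (n : ℤ) : ℤ) : ℝ) - ((P.eval (j : ℤ) : ℤ) : ℝ) = c * k * z := by
        exact_mod_cast hz
      rw [hp, hp]; linarith
    rw [hgphase, hpn, e_phase_congr hc hk hr]
  have hmeas : ∀ j, Measurable fun x => e (phase k l q r u t s (p j) x) := fun j =>
    continuous_e.measurable.comp (measurable_phase k l q r u t s (p j))
  have hper : ∀ j, Function.Periodic (fun x => e (phase k l q r u t s (p j) x)) (K : ℝ) :=
    fun j => e_phase_periodic hc hk hq hr u t s (p j)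
  have hlim := tendsto_avg_of_residues hP hA _ hK hax
    (F := fun j x => e (phase k l q r u t s (p j) x)) hper
    (fun j y => (norm_e _).le) hmeas
    (fun j => isClosed_phaseSingularities k l (p j))
    (fun j => nonempty_phaseSingularities k l (p j))
    (fun j => countable_phaseSingularities hk hl0 (p j))
    (fun j y => add_mem_phaseSingularities_iff c hk l (p j) y)
    (fun j y hy => continuousAt_e_phase k l q r u t s (p j) hy) hgres
  have hshift := tendsto_avg_shift (C := 1) (fun n => (norm_e _).le) hlim 1
  have hfun : (fun N : ℕ => (N : ℂ)⁻¹ * ∑ n ∈ Finset.Icc 1 N, g n)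
      = avg fun n => g (n + 1) := by
    funext N
    rw [avg, Finset.range_eq_Ico, Finset.sum_Ico_add' (c := 1)]
    rfl
  rw [hfun]
  have hzero : ∀ L : ℂ, Tendsto (avg fun n => g (n + 1)) atTop (nhds L) →
      (Tendsto (avg fun n => g (n + 1)) atTop (nhds 0) ↔ L = 0) := fun L hL =>
    ⟨fun h => tendsto_nhds_unique hL h, fun h => h ▸ hL⟩
  rw [hzero _ hshift]
  have hmean : ∀ j, (K : ℂ)⁻¹ * ∫ x in (0 : ℝ)..K, e (phase k l q r u t s (p j) x) =
      e (-(r * u)) * (e ((r + s) * p j / k) * ((M : ℂ)⁻¹ * ∑ i ∈ Finset.range M,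
        e (i * w + bval p k l t s j i) *
          ((∫ v in (0 : ℝ)..(min (xval p k j i) 1), e (v * w))
            + e s * ∫ v in (min (xval p k j i) 1)..1, e (v * w)))) := by
    intro j
    rw [mean_eq_sum_cells hl hMK k (hper j) (hmeas j) fun x => (norm_e _).le,
      Finset.sum_congr rfl fun i _ => integral_e_phase_cell hk hl q r u t s p j i,
      ← Finset.mul_sum, ← Finset.mul_sum]
    ring
  simp only [hmean]
  rw [← Finset.mul_sum, mul_left_comm, mul_eq_zero, or_iff_right (e_ne_zero _)]
  by_cases hw0 : w = 0
  · simp only [hw0, true_and, ne_eq, not_true_eq_false, false_and, or_false,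
      mul_zero, zero_add, e_zero, intervalIntegral.integral_const, Complex.real_smul]
    refine Eq.congr_left ?_
    refine congrArg _ (Finset.sum_congr rfl fun j _ => ?_)
    refine congrArg _ (congrArg _ (Finset.sum_congr rfl fun i _ => ?_))
    push_cast; ring
  · have hc0 : (2 * (Real.pi : ℂ) * Complex.I * w)⁻¹ ≠ 0 := by
      simp [Real.pi_ne_zero, hw0]
    simp only [hw0, false_and, false_or, ne_eq, not_false_eq_true, true_and, integral_e_mul hw0]
    have hiff : ∀ X Y : ℂ, X = (2 * (Real.pi : ℂ) * Complex.I * w)⁻¹ * Y → (X = 0 ↔ Y = 0) :=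
      fun X Y hXY => by rw [hXY, mul_eq_zero, or_iff_right hc0]
    refine hiff _ _ ?_
    simp only [Finset.mul_sum]
    refine Finset.sum_congr rfl fun j _ => Finset.sum_congr rfl fun i _ => ?_
    rw [mul_zero, e_zero, mul_one]
    ring

end
end

section
/- Let G be an abelian group and C ⊆ sub(G)^ω a CMS-family. Let s ≥ 0 and d, d' ≥ 1 be integers, and let G₁, …, G_s, H₁, …, H_d, H'₁, …, H'_{d'} be subgroups of G. If (G₁, …, G_s, H₁, …, H_d) ∈ C and (G₁, …, G_s, H'₁, …, H'_{d'}) ∈ C, then the tuple consisting of G₁, …, G_s followed by the d·d' subgroups H_i + H'_{i'} for i ∈ {1, …, d} and i' ∈ {1, …, d'} (listed in any fixed order, e.g. lexicographic in (i, i')) also belongs to C. -/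
noncomputable section

/-- A CMS-family: a collection of finite tuples (lists) of subgroups of an abelian group `G`,
closed under concatenation of last entries, extension by an arbitrary subgroup, and
permutation of entries. -/
structure IsCMSFamily (G : Type*) [AddCommGroup G] (C : Set (List (AddSubgroup G))) : Prop where
  concat : ∀ (L : List (AddSubgroup G)) (H H' : AddSubgroup G),
    L ++ [H] ∈ C → L ++ [H'] ∈ C → L ++ [H ⊔ H'] ∈ C
  mono : ∀ (L : List (AddSubgroup G)) (H : AddSubgroup G), L ∈ C → L ++ [H] ∈ C
  symm : ∀ L L' : List (AddSubgroup G), L ∈ C → L.Perm L' → L' ∈ C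

namespace IsCMSFamily

variable {G : Type*} [AddCommGroup G] {C : Set (List (AddSubgroup G))}

theorem append_mem (hC : IsCMSFamily G C) {L : List (AddSubgroup G)} (hL : L ∈ C)
    (M : List (AddSubgroup G)) : L ++ M ∈ C := by
  induction M generalizing L with
  | nil => simpa using hL
  | cons a M ih => simpa using ih (hC.mono L a hL)

theorem append_right_comm_mem (hC : IsCMSFamily G C) {L M N : List (AddSubgroup G)}
    (h : L ++ M ++ N ∈ C) : L ++ N ++ M ∈ C :=
  hC.symm _ _ h (by simpa using List.perm_append_comm.append_left L)

theorem append_map_sup_mem (hC : IsCMSFamily G C) {L B : List (AddSubgroup G)}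
    {a : AddSubgroup G} (ha : L ++ [a] ∈ C) (hB : L ++ B ∈ C) :
    L ++ B.map (a ⊔ ·) ∈ C := by
  induction B generalizing L with
  | nil => simpa using hB
  | cons b B ih =>
    have hLb : L ++ [b] ++ B.map (a ⊔ ·) ∈ C :=
      ih (hC.append_right_comm_mem (hC.mono _ b ha)) (by simpa using hB)
    have hLa : L ++ [a] ++ B.map (a ⊔ ·) ∈ C := hC.append_mem ha _
    simpa using hC.append_right_comm_mem (hC.concat _ a b
      (hC.append_right_comm_mem hLa) (hC.append_right_comm_mem hLb))

theorem append_flatMap_sup_mem (hC : IsCMSFamily G C) {L A B : List (AddSubgroup G)}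
    (hA : L ++ A ∈ C) (hB : L ++ B ∈ C) :
    L ++ A.flatMap (fun a => B.map (a ⊔ ·)) ∈ C := by
  induction A generalizing L with
  | nil => simpa using hA
  | cons a A ih =>
    have hLa : L ++ [a] ++ A.flatMap (fun a => B.map (a ⊔ ·)) ∈ C :=
      ih (by simpa using hA) (hC.append_right_comm_mem (hC.mono _ a hB))
    have hLB : L ++ B ++ A.flatMap (fun a => B.map (a ⊔ ·)) ∈ C := hC.append_mem hB _
    simpa using hC.append_right_comm_mem (hC.append_map_sup_mem
      (hC.append_right_comm_mem hLa) (hC.append_right_comm_mem hLB))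

end IsCMSFamily

/-- Let `C` be a CMS-family of tuples of subgroups of an abelian group `G`.
If `(G₁, …, G_s, H₁, …, H_d) ∈ C` and `(G₁, …, G_s, H'₁, …, H'_{d'}) ∈ C`, then the tuple
consisting of `G₁, …, G_s` followed by the `d·d'` subgroups `H_i + H'_{i'}` (in lexicographic
order of `(i, i')`) also belongs to `C`. -/
theorem stmt12 {G : Type*} [AddCommGroup G] (C : Set (List (AddSubgroup G)))
    (hC : IsCMSFamily G C) (s d d' : ℕ) (hd : 1 ≤ d) (hd' : 1 ≤ d')
    (Gs : Fin s → AddSubgroup G) (H : Fin d → AddSubgroup G) (H' : Fin d' → AddSubgroup G)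
    (h1 : List.ofFn Gs ++ List.ofFn H ∈ C)
    (h2 : List.ofFn Gs ++ List.ofFn H' ∈ C) :
    List.ofFn Gs ++
      ((List.finRange d).flatMap fun i => (List.finRange d').map fun i' => H i ⊔ H' i') ∈ C := by
  simpa [List.ofFn_eq_map, List.flatMap_map, List.map_map, Function.comp_def] using
    hC.append_flatMap_sup_mem h1 h2

end
end
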